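/- (Completeness of the pan-integrable function space) Let (X, 𝒜, μ) be a monotone measure space with μ subadditive and continuous from below, let E ∈ 𝒜 and p ≥ 1. Then L^p_μ(E) equipped with ρ(f,g) = ‖f − g‖_{μ,p} is complete: for every sequence (f_k) in L^p_μ(E) which is Cauchy with respect to ρ (i.e. ‖f_k − f_m‖_{μ,p} → 0 as k, m → ∞), there exists f ∈ L^p_μ(E) such that ‖f_k − f‖_{μ,p} → 0 as k → ∞. -/

import Mathlib

open Set Filter
open scoped ENNReal NNReal Topology

variable {X : Type*}

/-- A monotone measure: vanishes on the empty set, positive on the whole space,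
and monotone on measurable sets. -/
structure MonotoneMeasure [MeasurableSpace X] (mu : Set X → ℝ≥0∞) : Prop where
  empty : mu ∅ = 0
  univ_pos : 0 < mu Set.univ
  mono : ∀ ⦃A B : Set X⦄, MeasurableSet A → MeasurableSet B → A ⊆ B → mu A ≤ mu B

/-- A finite measurable partition of `X`. -/
def IsPanPartition [MeasurableSpace X] {n : ℕ} (A : Fin n → Set X) : Prop :=
  (∀ i, MeasurableSet (A i)) ∧ Pairwise (Function.onFun Disjoint A) ∧ (⋃ i, A i) = Set.univ

/-- The `(+,·)`-based pan-integral of a nonnegative function on `X`. -/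
noncomputable def panIntegral [MeasurableSpace X] (mu : Set X → ℝ≥0∞) (f : X → ℝ≥0∞) : ℝ≥0∞ :=
  ⨆ (n : ℕ) (A : Fin n → Set X) (_ : IsPanPartition A) (lam : Fin n → ℝ≥0)
    (_ : ∀ x, ∑ i, Set.indicator (A i) (fun _ => (lam i : ℝ≥0∞)) x ≤ f x),
    ∑ i, (lam i : ℝ≥0∞) * mu (A i)

/-- The pan-integral of `f` on a set `A`, i.e. the pan-integral of `f·χ_A` on `X`. -/
noncomputable def panIntegralOn [MeasurableSpace X] (mu : Set X → ℝ≥0∞) (f : X → ℝ≥0∞)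
    (A : Set X) : ℝ≥0∞ :=
  panIntegral mu (A.indicator f)

/-- Subadditivity of a set function. -/
def PanSubadditive [MeasurableSpace X] (mu : Set X → ℝ≥0∞) : Prop :=
  ∀ ⦃A B : Set X⦄, MeasurableSet A → MeasurableSet B → mu (A ∪ B) ≤ mu A + mu B

/-- Null-additivity of a set function. -/
def PanNullAdditive [MeasurableSpace X] (mu : Set X → ℝ≥0∞) : Prop :=
  ∀ ⦃A B : Set X⦄, MeasurableSet A → MeasurableSet B → mu B = 0 → mu (A ∪ B) = mu A

/-- Continuity from below of a set function. -/
def PanContinuousFromBelow [MeasurableSpace X] (mu : Set X → ℝ≥0∞) : Prop :=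
  ∀ E : ℕ → Set X, (∀ n, MeasurableSet (E n)) → Monotone E →
    Filter.Tendsto (fun n => mu (E n)) Filter.atTop (nhds (mu (⋃ n, E n)))

/-- A real-valued function is pan-integrable if the pan-integrals of its
positive and negative parts are both finite. -/
def PanIntegrable [MeasurableSpace X] (mu : Set X → ℝ≥0∞) (f : X → ℝ) : Prop :=
  panIntegral mu (fun x => ENNReal.ofReal (f x)) < ⊤ ∧
    panIntegral mu (fun x => ENNReal.ofReal (-f x)) < ⊤

/-- The symmetric pan-integral of a real-valued function:
`∫ f⁺ dμ − ∫ f⁻ dμ`. -/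
noncomputable def panIntegralReal [MeasurableSpace X] (mu : Set X → ℝ≥0∞) (f : X → ℝ) : ℝ :=
  (panIntegral mu (fun x => ENNReal.ofReal (f x))).toReal -
    (panIntegral mu (fun x => ENNReal.ofReal (-f x))).toReal

/-- The `‖·‖_{μ,p}` functional: `(∫_E^pan |f|^p dμ)^(1/p)`. -/
noncomputable def panNorm [MeasurableSpace X] (mu : Set X → ℝ≥0∞) (E : Set X) (p : ℝ)
    (f : X → ℝ) : ℝ≥0∞ :=
  (panIntegralOn mu (fun x => ENNReal.ofReal (|f x| ^ p)) E) ^ (1 / p)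

section PanIntegral

open MeasureTheory

variable [MeasurableSpace X] {mu : Set X → ℝ≥0∞}

theorem isSigmaSubadditiveSetFun_of_continuousFromBelow (hempty : mu ∅ = 0)
    (hsub : PanSubadditive mu) (hcb : PanContinuousFromBelow mu) :
    IsSigmaSubadditiveSetFun mu := by
  intro s _
  let U : ℕ → Set X := fun n => ⋃ i ∈ Finset.range n, (s i : Set X)
  have hU : ∀ n, MeasurableSet (U n) := fun n =>
    Finset.measurableSet_biUnion _ fun i _ => (s i).2
  have hmono : Monotone U := fun m n hmn =>
    biUnion_subset_biUnion_left fun i hi =>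
      Finset.mem_range.2 ((Finset.mem_range.1 hi).trans_le hmn)
  have hle : ∀ n, mu (U n) ≤ ∑ i ∈ Finset.range n, mu (s i) := by
    intro n
    induction n with
    | zero => simp [U, hempty]
    | succ n ih =>
      have hsucc : U (n + 1) = U n ∪ s n := by
        simp only [U, Finset.range_add_one, Finset.set_biUnion_insert, Set.union_comm]
      rw [hsucc, Finset.sum_range_succ]
      exact (hsub (hU n) (s n).2).trans (add_le_add_left ih _)
  have hunion : ⋃ n, U n = ⋃ i, (s i : Set X) := by
    ext x
    simp only [U, mem_iUnion, Finset.mem_range, exists_prop]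
    exact ⟨fun ⟨_, i, _, hx⟩ => ⟨i, hx⟩, fun ⟨i, hx⟩ => ⟨i + 1, i, i.lt_succ_self, hx⟩⟩
  rw [← hunion]
  exact le_of_tendsto' (hcb U hU hmono) fun n => (hle n).trans (ENNReal.sum_le_tsum _)

theorem sum_mul_le_panIntegral {ι : Type*} [Fintype ι] {A : ι → Set X} {lam : ι → ℝ≥0}
    {f : X → ℝ≥0∞} (hA : ∀ i, MeasurableSet (A i)) (hdisj : Pairwise (Function.onFun Disjoint A))
    (hcover : ⋃ i, A i = univ) (hle : ∀ i, ∀ x ∈ A i, (lam i : ℝ≥0∞) ≤ f x) :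
    ∑ i, (lam i : ℝ≥0∞) * mu (A i) ≤ panIntegral mu f := by
  let e := (Fintype.equivFin ι).symm
  have hpart : IsPanPartition (A ∘ e) :=
    ⟨fun i => hA (e i), fun i j hij => hdisj (e.injective.ne hij),
      (e.surjective.iUnion_comp A).trans hcover⟩
  have hbound : ∀ x, ∑ i, Set.indicator ((A ∘ e) i) (fun _ => ((lam ∘ e) i : ℝ≥0∞)) x ≤ f x := by
    intro x
    obtain ⟨i, hi⟩ := mem_iUnion.1 (hcover.symm ▸ mem_univ x)
    simp only [Function.comp_apply]
    rw [e.sum_comp fun i => Set.indicator (A i) (fun _ => (lam i : ℝ≥0∞)) x,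
      Finset.sum_eq_single i
        (fun j _ hj => indicator_of_notMem (fun hx => (hdisj hj).le_bot ⟨hx, hi⟩) _)
        (fun h => absurd (Finset.mem_univ i) h), indicator_of_mem hi]
    exact hle i x hi
  rw [← e.sum_comp fun i => (lam i : ℝ≥0∞) * mu (A i)]
  exact le_iSup_of_le _ <| le_iSup_of_le (A ∘ e) <| le_iSup_of_le hpart <|
    le_iSup_of_le (lam ∘ e) <| le_iSup_of_le hbound le_rfl

theorem le_preVariation (hempty : mu ∅ = 0) (hσ : IsSigmaSubadditiveSetFun mu) {s : Set X}
    (hs : MeasurableSet s) : mu s ≤ preVariation mu hσ hempty s := by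
  rw [preVariation_apply, VectorMeasure.ennrealToMeasure_apply hs, ennrealPreVariation_apply]
  rcases s.eq_empty_or_nonempty with rfl | hne
  · simp [hempty]
  · have hbot : (⟨s, hs⟩ : Subtype (MeasurableSet (α := X))) ≠ ⊥ := fun h =>
      hne.ne_empty (congrArg Subtype.val h)
    simpa using preVariation.sum_le mu hs (Finpartition.indiscrete hbot)

theorem simpleFunc_lintegral_preVariation_le_panIntegral (hempty : mu ∅ = 0)
    (hσ : IsSigmaSubadditiveSetFun mu) (φ : SimpleFunc X ℝ≥0) {f : X → ℝ≥0∞}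
    (hφ : ∀ x, (φ x : ℝ≥0∞) ≤ f x) :
    (φ.map ((↑) : ℝ≥0 → ℝ≥0∞)).lintegral (preVariation mu hσ hempty) ≤ panIntegral mu f := by
  have hm : ∀ c, MeasurableSet (φ ⁻¹' {c}) := φ.measurableSet_fiber
  let Q : ℝ≥0 → Type _ := fun c => Finpartition (⟨φ ⁻¹' {c}, hm c⟩ : Subtype MeasurableSet)
  let S : ∀ c, Q c → ℝ≥0∞ := fun c P => ∑ q ∈ P.parts, mu q
  have hν : ∀ c, preVariation mu hσ hempty (φ ⁻¹' {c}) = ⨆ P : ∀ c, Q c, S c (P c) := by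
    intro c
    rw [preVariation_apply, VectorMeasure.ennrealToMeasure_apply (hm c),
      ennrealPreVariation_apply, preVariationFun_apply mu (hm c)]
    have hsurj : Function.Surjective fun P : ∀ c, Q c => P c := Function.surjective_eval c
    exact (hsurj.iSup_comp (S c)).symm
  simp only [SimpleFunc.map_lintegral, hν, ENNReal.mul_iSup]
  rw [ENNReal.finsetSum_iSup]
  swap
  · intro P P'
    classical
    refine ⟨fun c => if S c (P c) ≤ S c (P' c) then P' c else P c, fun c => ?_⟩
    dsimp only
    split_ifs with h
    · exact ⟨by gcongr, le_rfl⟩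
    · exact ⟨le_rfl, by gcongr; exact (not_le.1 h).le⟩
  refine iSup_le fun P => ?_
  let ι := Σ c : φ.range, (P c).parts
  let A : ι → Set X := fun i => i.2.1.1
  have hsub : ∀ i : ι, A i ⊆ φ ⁻¹' {(i.1 : ℝ≥0)} := fun i => (P i.1).le i.2.2
  have key := sum_mul_le_panIntegral (mu := mu) (A := A) (lam := fun i => (i.1 : ℝ≥0)) (f := f)
    (fun i => i.2.1.2) ?_ ?_ ?_
  · refine le_trans (le_of_eq ?_) key
    rw [Fintype.sum_sigma, ← Finset.sum_coe_sort φ.range]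
    refine Finset.sum_congr rfl fun c _ => ?_
    simp only [S, A, ← Finset.mul_sum, ← Finset.sum_coe_sort (P c).parts]
  · rintro ⟨c, q⟩ ⟨d, r⟩ hne
    by_cases hcd : c = d
    · subst hcd
      have hqr : q.1 ≠ r.1 := fun h => hne (by rw [Subtype.ext h])
      have hd := (P c).disjoint q.2 r.2 hqr
      exact Set.disjoint_iff_inter_eq_empty.2 (congrArg Subtype.val hd.eq_bot)
    · refine Set.disjoint_left.2 fun x hx hx' => hcd (Subtype.ext ?_)
      exact (hsub ⟨c, q⟩ hx).symm.trans (hsub ⟨d, r⟩ hx')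
  · refine eq_univ_of_forall fun x => ?_
    have hx : x ∈ (((P (φ x)).parts.sup id : Subtype MeasurableSet) : Set X) := by
      rw [(P (φ x)).sup_parts]
      rfl
    rw [Finset.sup_coe (Psup := by measurability), Finset.sup_set_eq_biUnion] at hx
    obtain ⟨q, hq, hxq⟩ := mem_iUnion₂.1 hx
    exact mem_iUnion.2 ⟨⟨⟨φ x, φ.mem_range_self x⟩, ⟨q, hq⟩⟩, hxq⟩
  · intro i x hx
    rw [← hsub i hx]
    exact hφ x

theorem panIntegral_eq_lintegral_preVariation (hempty : mu ∅ = 0)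
    (hσ : IsSigmaSubadditiveSetFun mu) (f : X → ℝ≥0∞) :
    panIntegral mu f = ∫⁻ x, f x ∂(preVariation mu hσ hempty) := by
  apply le_antisymm
  · refine iSup_le fun n => iSup_le fun A => iSup_le fun hA => iSup_le fun lam =>
      iSup_le fun hle => ?_
    calc ∑ i, (lam i : ℝ≥0∞) * mu (A i)
        ≤ ∑ i, (lam i : ℝ≥0∞) * preVariation mu hσ hempty (A i) := by
          gcongr with i
          exact le_preVariation hempty hσ (hA.1 i)
      _ = ∫⁻ x, ∑ i, (A i).indicator (fun _ => (lam i : ℝ≥0∞)) x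
            ∂(preVariation mu hσ hempty) := by
          rw [lintegral_finsetSum _ fun i _ => measurable_const.indicator (hA.1 i)]
          simp only [lintegral_indicator_const (hA.1 _)]
      _ ≤ ∫⁻ x, f x ∂(preVariation mu hσ hempty) := lintegral_mono hle
  · rw [lintegral_eq_nnreal]
    exact iSup₂_le fun φ hφ => simpleFunc_lintegral_preVariation_le_panIntegral hempty hσ φ hφ

theorem panNorm_eq_eLpNorm (hempty : mu ∅ = 0) (hσ : IsSigmaSubadditiveSetFun mu) {E : Set X}
    (hE : MeasurableSet E) {p : ℝ} (hp : 0 < p) (f : X → ℝ) :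
    panNorm mu E p f =
      eLpNorm f (ENNReal.ofReal p) ((preVariation mu hσ hempty).restrict E) := by
  rw [eLpNorm_eq_lintegral_rpow_enorm_toReal (by simpa using hp) ENNReal.ofReal_ne_top,
    ENNReal.toReal_ofReal hp.le, panNorm, panIntegralOn,
    panIntegral_eq_lintegral_preVariation hempty hσ, lintegral_indicator hE]
  congr! 3 with x
  rw [← ENNReal.ofReal_rpow_of_nonneg (abs_nonneg _) hp.le, Real.enorm_eq_ofReal_abs]

end PanIntegral

theorem panLp_complete [MeasurableSpace X]
    (mu : Set X → ℝ≥0∞) (hmu : MonotoneMeasure mu) (hsub : PanSubadditive mu)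
    (hcb : PanContinuousFromBelow mu)
    {E : Set X} (hE : MeasurableSet E) (p : ℝ) (hp : 1 ≤ p)
    (f : ℕ → X → ℝ) (hf : ∀ k, Measurable (f k))
    (hmem : ∀ k, panNorm mu E p (f k) < ⊤)
    (hcauchy : ∀ ε : ℝ≥0∞, 0 < ε → ∃ N : ℕ, ∀ k ≥ N, ∀ m ≥ N,
      panNorm mu E p (fun x => f k x - f m x) < ε) :
    ∃ g : X → ℝ, Measurable g ∧ panNorm mu E p g < ⊤ ∧
      Filter.Tendsto (fun k => panNorm mu E p (fun x => f k x - g x))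
        Filter.atTop (nhds 0) := by
  have hσ := isSigmaSubadditiveSetFun_of_continuousFromBelow hmu.empty hsub hcb
  simp only [panNorm_eq_eLpNorm hmu.empty hσ hE (zero_lt_one.trans_le hp)] at hmem hcauchy ⊢
  have : Fact (1 ≤ ENNReal.ofReal p) := ⟨ENNReal.one_le_ofReal.2 hp⟩
  have hLp : ∀ k, MeasureTheory.MemLp (f k) (ENNReal.ofReal p) _ := fun k =>
    ⟨(hf k).aestronglyMeasurable, hmem k⟩
  have hF : CauchySeq fun k => (hLp k).toLp (f k) := by
    refine EMetric.cauchySeq_iff.2 fun ε hε => ?_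
    obtain ⟨N, hN⟩ := hcauchy ε hε
    refine ⟨N, fun k hk m hm => ?_⟩
    rw [MeasureTheory.Lp.edist_toLp_toLp]
    exact hN k hk m hm
  obtain ⟨g, hg⟩ := cauchySeq_tendsto_of_complete hF
  refine ⟨g, (MeasureTheory.Lp.stronglyMeasurable g).measurable,
    MeasureTheory.Lp.eLpNorm_lt_top g, ?_⟩
  rw [← MeasureTheory.Lp.toLp_coeFn g (MeasureTheory.Lp.memLp g)] at hg
  exact (MeasureTheory.Lp.tendsto_Lp_iff_tendsto_eLpNorm'' f hLp g
    (MeasureTheory.Lp.memLp g)).1 hg
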